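/- Let 1 ≤ p < q < ∞, d ≥ 1, and 0 < r < 1. Define f(x) := |x|^{−d/q}, g(x) := χ_{(0,1)}(|x|) f(x), h(x) := f(x) − g(x), and u := (1+r)g + (1−r)h. Then ((‖f‖_{M^p_q} + ‖u‖_{M^p_q}) / ‖f − u‖_{M^p_q}) · ‖ f/‖f‖_{M^p_q} − u/‖u‖_{M^p_q} ‖_{M^p_q} = (4 + 2r)/(1 + r). -/

import Mathlib

open MeasureTheory
open scoped ENNReal

/-- The Morrey norm `‖f‖_{M^p_q}` of a (measurable) function on `ℝ^d`:
the supremum over all balls `B = B(a,r)` of `|B|^(1/q - 1/p) (∫_B |f|^p)^(1/p)`. -/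
noncomputable def morreyNorm (p q : ℝ) (d : ℕ) (f : EuclideanSpace ℝ (Fin d) → ℝ) : ℝ≥0∞ :=
  ⨆ (a : EuclideanSpace ℝ (Fin d)) (r : ℝ) (_ : 0 < r),
    volume (Metric.ball a r) ^ ((1:ℝ)/q - 1/p) *
      (∫⁻ y in Metric.ball a r, ENNReal.ofReal (|f y| ^ p)) ^ ((1:ℝ)/p)

open Filter Topology Set

/-- The quantity inside the supremum defining the Morrey norm, for the ball `B(a, s)`. -/
noncomputable def morreyBall (p q : ℝ) (d : ℕ) (f : EuclideanSpace ℝ (Fin d) → ℝ)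
    (a : EuclideanSpace ℝ (Fin d)) (s : ℝ) : ℝ≥0∞ :=
  volume (Metric.ball a s) ^ ((1:ℝ)/q - 1/p) *
    (∫⁻ y in Metric.ball a s, ENNReal.ofReal (|f y| ^ p)) ^ ((1:ℝ)/p)

section

variable {p q : ℝ} {d : ℕ} {f F G : EuclideanSpace ℝ (Fin d) → ℝ}

lemma morreyNorm_eq_iSup_morreyBall :
    morreyNorm p q d F = ⨆ (a : EuclideanSpace ℝ (Fin d)) (s : ℝ) (_ : 0 < s),
      morreyBall p q d F a s := rfl

lemma morreyBall_le_morreyNorm (a : EuclideanSpace ℝ (Fin d)) {s : ℝ} (hs : 0 < s) :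
    morreyBall p q d F a s ≤ morreyNorm p q d F :=
  le_iSup₂_of_le a s (le_iSup_of_le hs le_rfl)

lemma morreyNorm_le_iff {C : ℝ≥0∞} :
    morreyNorm p q d F ≤ C ↔
      ∀ (a : EuclideanSpace ℝ (Fin d)) (s : ℝ), 0 < s → morreyBall p q d F a s ≤ C := by
  simp only [morreyNorm_eq_iSup_morreyBall, iSup_le_iff]

lemma morreyNorm_mono (hp : 0 < p) (h : ∀ x, |F x| ≤ |G x|) :
    morreyNorm p q d F ≤ morreyNorm p q d G := by
  refine morreyNorm_le_iff.2 fun a s hs => le_trans ?_ (morreyBall_le_morreyNorm a hs)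
  unfold morreyBall
  gcongr _ * (∫⁻ x in _, ENNReal.ofReal (?_ ^ _)) ^ _ with x
  exact h x

lemma morreyBall_smul (hp : 0 < p) (c : ℝ) (a : EuclideanSpace ℝ (Fin d)) (s : ℝ) :
    morreyBall p q d (c • F) a s = ENNReal.ofReal |c| * morreyBall p q d F a s := by
  have h : ∀ y, ENNReal.ofReal (|(c • F) y| ^ p)
      = ENNReal.ofReal |c| ^ p * ENNReal.ofReal (|F y| ^ p) := fun y => by
    rw [Pi.smul_apply, smul_eq_mul, abs_mul, Real.mul_rpow (abs_nonneg _) (abs_nonneg _),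
      ENNReal.ofReal_mul (by positivity), ENNReal.ofReal_rpow_of_nonneg (abs_nonneg _) hp.le]
  unfold morreyBall
  simp only [h]
  rw [lintegral_const_mul' _ _ (by finiteness), ENNReal.mul_rpow_of_nonneg _ _ (by positivity),
    ← ENNReal.rpow_mul, mul_one_div_cancel hp.ne', ENNReal.rpow_one, mul_left_comm]

lemma morreyNorm_smul (hp : 0 < p) (c : ℝ) :
    morreyNorm p q d (c • F) = ENNReal.ofReal |c| * morreyNorm p q d F := by
  simp only [morreyNorm_eq_iSup_morreyBall, morreyBall_smul hp, ENNReal.mul_iSup]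

lemma setLIntegral_ball_comp_smul {φ : EuclideanSpace ℝ (Fin d) → ℝ≥0∞} (hφ : Measurable φ)
    {t : ℝ} (ht : 0 < t) (a : EuclideanSpace ℝ (Fin d)) (s : ℝ) :
    ∫⁻ y in Metric.ball a s, φ (t • y)
      = ENNReal.ofReal (t ^ (-(d : ℝ))) * ∫⁻ y in Metric.ball (t • a) (t * s), φ y := by
  have h := setLIntegral_map (μ := (volume : Measure (EuclideanSpace ℝ (Fin d))))
    (Metric.isOpen_ball (x := t • a) (ε := t * s)).measurableSet hφ (measurable_const_smul t)
  rw [Measure.map_addHaar_smul volume ht.ne', Measure.restrict_smul, lintegral_smul_measure] at h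
  have hball : (fun x : EuclideanSpace ℝ (Fin d) => t • x) ⁻¹' Metric.ball (t • a) (t * s)
      = Metric.ball a s := by
    ext x
    simp [dist_smul₀, abs_of_pos ht, ht]
  rw [hball] at h
  rw [← h, smul_eq_mul, finrank_euclideanSpace_fin, Real.rpow_neg ht.le, Real.rpow_natCast,
    abs_of_nonneg (by positivity)]

lemma morreyBall_dilation (hp : 0 < p) (hF : Measurable F) {t : ℝ} (ht : 0 < t)
    (a : EuclideanSpace ℝ (Fin d)) {s : ℝ} (hs : 0 < s) :
    morreyBall p q d (t ^ ((d : ℝ) / q) • fun x => F (t • x)) a s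
      = morreyBall p q d F (t • a) (t * s) := by
  rw [morreyBall_smul hp]
  have hV := setLIntegral_ball_comp_smul (φ := fun _ => 1) measurable_const ht a s
  have hI := setLIntegral_ball_comp_smul (φ := fun y => ENNReal.ofReal (|F y| ^ p))
    (by fun_prop) ht a s
  simp only [setLIntegral_one] at hV
  have hk : ENNReal.ofReal (t ^ (-(d : ℝ))) ≠ 0 := by
    simpa only [ne_eq, ENNReal.ofReal_eq_zero, not_le] using Real.rpow_pos_of_pos ht _
  have hv : volume (Metric.ball (t • a) (t * s)) ≠ 0 :=
    (Metric.measure_ball_pos _ _ (by positivity)).ne'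
  unfold morreyBall
  rw [hV, hI, ENNReal.mul_rpow_of_ne_zero hk hv, ENNReal.mul_rpow_of_nonneg _ _ (by positivity)]
  rw [show ∀ A B C D E : ℝ≥0∞, A * (B * C * (D * E)) = (A * (B * D)) * (C * E) by
    intros; ring, ← ENNReal.rpow_add _ _ hk (by finiteness), sub_add_cancel,
    ENNReal.ofReal_rpow_of_pos (by positivity), ← Real.rpow_mul ht.le,
    abs_of_nonneg (by positivity), ← ENNReal.ofReal_mul (by positivity), ← Real.rpow_add ht]
  simp [div_eq_mul_inv]

lemma morreyNorm_dilation_le (hp : 0 < p) (hF : Measurable F) {t : ℝ} (ht : 0 < t) :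
    morreyNorm p q d (t ^ ((d : ℝ) / q) • fun x => F (t • x)) ≤ morreyNorm p q d F := by
  refine morreyNorm_le_iff.2 fun a s hs => ?_
  rw [morreyBall_dilation hp hF ht a hs]
  exact morreyBall_le_morreyNorm _ (by positivity)

lemma morreyNorm_le_of_monotone_tendsto (hp : 0 < p) {C : ℝ≥0∞}
    {u : ℕ → EuclideanSpace ℝ (Fin d) → ℝ} (hu : ∀ n, Measurable (u n))
    (hmono : ∀ x, Monotone fun n => |u n x|)
    (hlim : ∀ x, Tendsto (fun n => u n x) atTop (𝓝 (F x)))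
    (hC : ∀ n, morreyNorm p q d (u n) ≤ C) : morreyNorm p q d F ≤ C := by
  refine morreyNorm_le_iff.2 fun a s hs => ?_
  have h := lintegral_tendsto_of_tendsto_of_monotone
    (μ := volume.restrict (Metric.ball a s))
    (f := fun n x => ENNReal.ofReal (|u n x| ^ p)) (F := fun x => ENNReal.ofReal (|F x| ^ p))
    (fun n => by have := hu n; fun_prop)
    (ae_of_all _ fun x m n hmn => ENNReal.ofReal_le_ofReal
      (Real.rpow_le_rpow (abs_nonneg _) (hmono x hmn) hp.le))
    (ae_of_all _ fun x => ENNReal.tendsto_ofReal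
      ((hlim x).abs.rpow_const (Or.inr hp.le)))
  have hv : volume (Metric.ball a s) ^ ((1:ℝ)/q - 1/p) ≠ ∞ :=
    ENNReal.rpow_ne_top_of_ne_zero (Metric.measure_ball_pos _ _ hs).ne' measure_ball_lt_top.ne
  refine le_of_tendsto'
    (ENNReal.Tendsto.const_mul (((ENNReal.continuous_rpow_const (y := (1:ℝ)/p)).tendsto _).comp h)
      (Or.inr hv)) fun n => (morreyBall_le_morreyNorm a hs).trans (hC n)

/-- Restricting a function homogeneous of degree `-d/q` to a set whose dilates exhaust the space
away from the origin does not change its Morrey norm. -/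
lemma morreyNorm_indicator_eq (hp : 0 < p) (hf : Measurable f) (hf0 : f 0 = 0)
    (hhom : ∀ t : ℝ, 0 < t → (t ^ ((d : ℝ) / q) • fun x => f (t • x)) = f)
    {S : Set (EuclideanSpace ℝ (Fin d))} (hS : MeasurableSet S) {t : ℕ → ℝ} (ht : ∀ n, 0 < t n)
    (hmono : ∀ x, ∀ m n, m ≤ n → t m • x ∈ S → t n • x ∈ S)
    (hex : ∀ x ≠ 0, ∃ n, t n • x ∈ S) :
    morreyNorm p q d (S.indicator f) = morreyNorm p q d f := by
  classical
  have key : ∀ n x, (t n ^ ((d : ℝ) / q) • fun x => S.indicator f (t n • x)) x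
      = if t n • x ∈ S then f x else 0 := fun n x => by
    have := congrFun (hhom (t n) (ht n)) x
    simp only [Pi.smul_apply] at this ⊢
    by_cases h : t n • x ∈ S <;> simp [h]
    simpa using this
  refine le_antisymm (morreyNorm_mono hp fun x => ?_) ?_
  · by_cases h : x ∈ S <;> simp [h]
  · refine morreyNorm_le_of_monotone_tendsto hp
      (u := fun n => t n ^ ((d : ℝ) / q) • fun x => S.indicator f (t n • x))
      (fun n => ?_) (fun x m n hmn => ?_) (fun x => ?_)
      fun n => morreyNorm_dilation_le hp (hf.indicator hS) (ht n)
    · exact ((hf.indicator hS).comp (measurable_const_smul (t n))).const_smul _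
    · simp only [key]
      by_cases h : t m • x ∈ S
      · simp [h, hmono x m n hmn h]
      · simp [h]
    · simp only [key]
      by_cases hx : x = 0
      · simp [hx, hf0]
      · obtain ⟨N, hN⟩ := hex x hx
        refine tendsto_const_nhds.congr' ?_
        filter_upwards [eventually_ge_atTop N] with n hn
        simp [hmono x N n hn hN]

variable (hp : 0 < p) (hpq : p < q) (hd : 1 ≤ d)

lemma dilation_norm_rpow {t : ℝ} (ht : 0 < t) :
    (t ^ ((d : ℝ) / q) • fun x : EuclideanSpace ℝ (Fin d) => ‖t • x‖ ^ (-(d : ℝ) / q))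
      = fun x => ‖x‖ ^ (-(d : ℝ) / q) := by
  ext x
  rw [Pi.smul_apply, norm_smul, Real.norm_of_nonneg ht.le,
    Real.mul_rpow ht.le (norm_nonneg _), smul_eq_mul, ← mul_assoc, ← Real.rpow_add ht,
    ← add_div, add_neg_cancel, zero_div, Real.rpow_zero, one_mul]

include hp hpq hd

lemma lintegral_ball_norm_rpow_lt_top :
    ∫⁻ y in Metric.ball (0 : EuclideanSpace ℝ (Fin d)) 1,
      ENNReal.ofReal (|‖y‖ ^ (-(d : ℝ) / q)| ^ p) < ∞ := by
  have : Nonempty (Fin d) := ⟨⟨0, hd⟩⟩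
  have hd' : (1 : ℝ) ≤ d := by exact_mod_cast hd
  have hq : 0 < q := hp.trans hpq
  have h : IntegrableOn (fun x : EuclideanSpace ℝ (Fin d) => |‖x‖ ^ (-(d : ℝ) / q)| ^ p)
      (Metric.ball 0 1) := by
    rw [integrableOn_fun_norm_addHaar volume (f := fun y => |y ^ (-(d : ℝ) / q)| ^ p)]
    have hexp : -1 < ((d : ℝ) - 1) + (-(d : ℝ) / q) * p := by
      have : (d : ℝ) * (p / q) < d := by
        have : p / q < 1 := (div_lt_one hq).2 hpq
        nlinarith
      have e : (-(d : ℝ) / q) * p = -(d * (p / q)) := by ring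
      rw [e]; linarith
    refine ((intervalIntegral.integrableOn_Ioo_rpow_iff one_pos).2 hexp).congr_fun
      (fun y hy => ?_) measurableSet_Ioo
    simp only [finrank_euclideanSpace_fin, smul_eq_mul]
    rw [abs_of_nonneg (Real.rpow_nonneg hy.1.le _), ← Real.rpow_mul hy.1.le,
      Real.rpow_add hy.1, ← Real.rpow_natCast, Nat.cast_sub hd, Nat.cast_one]
  exact h.lintegral_lt_top

lemma morreyNorm_norm_rpow_ne_top :
    morreyNorm p q d (fun x => ‖x‖ ^ (-(d : ℝ) / q)) ≠ ∞ := by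
  set f : EuclideanSpace ℝ (Fin d) → ℝ := fun x => ‖x‖ ^ (-(d : ℝ) / q) with hf
  have hq : 0 < q := hp.trans hpq
  have hfm : Measurable f := by fun_prop
  set v := volume (Metric.ball (0 : EuclideanSpace ℝ (Fin d)) 1) with hv
  have hv0 : v ≠ 0 := (Metric.measure_ball_pos _ _ one_pos).ne'
  have hvt : v ≠ ∞ := measure_ball_lt_top.ne
  set I := ∫⁻ y in Metric.ball (0 : EuclideanSpace ℝ (Fin d)) 1, ENNReal.ofReal (|f y| ^ p)
  have hI : I ≠ ∞ := (lintegral_ball_norm_rpow_lt_top hp hpq hd).ne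
  have hbound : v ^ ((1:ℝ)/q - 1/p) * (I + v) ^ ((1:ℝ)/p) ≠ ∞ :=
    ENNReal.mul_ne_top (ENNReal.rpow_ne_top_of_ne_zero hv0 hvt)
      (ENNReal.rpow_ne_top_of_nonneg (by positivity) (by finiteness))
  refine ne_top_of_le_ne_top hbound (morreyNorm_le_iff.2 fun a s hs => ?_)
  rw [hf, ← dilation_norm_rpow (inv_pos.2 hs), morreyBall_dilation hp hfm (inv_pos.2 hs) a hs,
    inv_mul_cancel₀ hs.ne']
  generalize s⁻¹ • a = b
  unfold morreyBall
  rw [Measure.addHaar_ball_center volume b 1]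
  gcongr
  calc ∫⁻ y in Metric.ball b 1, ENNReal.ofReal (|f y| ^ p)
      ≤ ∫⁻ y in Metric.ball 0 1 ∪ Metric.ball b 1 \ Metric.ball 0 1,
          ENNReal.ofReal (|f y| ^ p) := lintegral_mono_set (by simp)
    _ ≤ I + ∫⁻ y in Metric.ball b 1 \ Metric.ball 0 1, ENNReal.ofReal (|f y| ^ p) :=
        lintegral_union_le _ _ _
    _ ≤ I + ∫⁻ y in Metric.ball b 1 \ Metric.ball 0 1, 1 := by
        gcongr 1
        refine setLIntegral_mono measurable_const fun y hy => ?_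
        have hy1 : 1 ≤ ‖y‖ := by simpa using hy.2
        refine ENNReal.ofReal_le_one.2 (Real.rpow_le_one (abs_nonneg _) ?_ hp.le)
        rw [abs_of_nonneg (by positivity)]
        exact Real.rpow_le_one_of_one_le_of_nonpos hy1
          (div_nonpos_of_nonpos_of_nonneg (by simp) hq.le)
    _ ≤ I + v := by
        rw [setLIntegral_one, hv, ← Measure.addHaar_ball_center volume b 1]
        gcongr
        exact sdiff_subset

lemma morreyNorm_norm_rpow_ne_zero :
    morreyNorm p q d (fun x => ‖x‖ ^ (-(d : ℝ) / q)) ≠ 0 := by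
  have : Nonempty (Fin d) := ⟨⟨0, hd⟩⟩
  have hq : 0 < q := hp.trans hpq
  refine (lt_of_lt_of_le ?_ (morreyBall_le_morreyNorm 0 one_pos)).ne'
  have hI : 0 < ∫⁻ y in Metric.ball (0 : EuclideanSpace ℝ (Fin d)) 1,
      ENNReal.ofReal (|‖y‖ ^ (-(d : ℝ) / q)| ^ p) := by
    rw [setLIntegral_pos_iff (by fun_prop)]
    have hpos : 0 < volume (Metric.ball (0 : EuclideanSpace ℝ (Fin d)) 1 \ {0}) := by
      rw [measure_sdiff_null (measure_singleton 0)]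
      exact Metric.measure_ball_pos _ _ one_pos
    refine hpos.trans_le (measure_mono fun y hy => ?_)
    refine ⟨?_, hy.1⟩
    have : 0 < ‖y‖ := norm_pos_iff.2 (by simpa using hy.2)
    simp only [Function.mem_support, ne_eq, ENNReal.ofReal_eq_zero, not_le]
    positivity
  exact ENNReal.mul_pos
    (ENNReal.rpow_pos (Metric.measure_ball_pos _ _ one_pos) measure_ball_lt_top.ne).ne'
    (ENNReal.rpow_pos hI (lintegral_ball_norm_rpow_lt_top hp hpq hd).ne).ne'

/-- The Morrey norm of `|x|^(-d/q)` multiplied by a function taking one constant value inside the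
unit ball and another one outside. -/
lemma morreyNorm_piecewise_norm_rpow (a b : ℝ)
    (hF : ∀ x, F x = (if ‖x‖ < 1 then a else b) * ‖x‖ ^ (-(d : ℝ) / q)) :
    morreyNorm p q d F
      = ENNReal.ofReal (max |a| |b|) * morreyNorm p q d (fun x => ‖x‖ ^ (-(d : ℝ) / q)) := by
  have hq : 0 < q := hp.trans hpq
  set f : EuclideanSpace ℝ (Fin d) → ℝ := fun x => ‖x‖ ^ (-(d : ℝ) / q) with hf
  have hfm : Measurable f := by fun_prop
  have hd0 : (d : ℝ) ≠ 0 := by positivity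
  have hf0 : f 0 = 0 := by
    simp only [hf, norm_zero]
    exact Real.zero_rpow (by simp [hd0, hq.ne', neg_div])
  have hfF : ∀ x, F x = (if ‖x‖ < 1 then a else b) * f x := hF
  have hhom : ∀ t : ℝ, 0 < t → (t ^ ((d : ℝ) / q) • fun x => f (t • x)) = f :=
    fun t ht => dilation_norm_rpow ht
  have hin : morreyNorm p q d ({x | ‖x‖ < 1}.indicator f) = morreyNorm p q d f := by
    refine morreyNorm_indicator_eq hp hfm hf0 hhom
      (measurableSet_lt measurable_norm measurable_const) (t := fun n => ((n : ℝ) + 1)⁻¹)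
      (fun n => by positivity) (fun x m n hmn h => ?_) (fun x hx => ?_)
    · simp only [mem_ofPred_eq, norm_smul, Real.norm_eq_abs] at h ⊢
      refine lt_of_le_of_lt ?_ h
      rw [abs_of_pos (by positivity), abs_of_pos (by positivity)]
      gcongr
    · obtain ⟨n, hn⟩ := exists_nat_gt ‖x‖
      refine ⟨n, ?_⟩
      simp only [mem_ofPred_eq, norm_smul, Real.norm_eq_abs]
      rw [abs_of_pos (by positivity), inv_mul_lt_one₀ (by positivity)]
      linarith
  have hout : morreyNorm p q d ({x | 1 ≤ ‖x‖}.indicator f) = morreyNorm p q d f := by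
    refine morreyNorm_indicator_eq hp hfm hf0 hhom
      (measurableSet_le measurable_const measurable_norm) (t := fun n => (n : ℝ) + 1)
      (fun n => by positivity) (fun x m n hmn h => ?_) (fun x hx => ?_)
    · simp only [mem_ofPred_eq, norm_smul, Real.norm_eq_abs] at h ⊢
      refine h.trans ?_
      rw [abs_of_pos (by positivity), abs_of_pos (by positivity)]
      gcongr
    · obtain ⟨n, hn⟩ := exists_nat_gt (‖x‖⁻¹)
      refine ⟨n, ?_⟩
      have hx' : 0 < ‖x‖ := norm_pos_iff.2 hx
      simp only [mem_ofPred_eq, norm_smul, Real.norm_eq_abs]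
      rw [abs_of_pos (by positivity)]
      rw [inv_lt_iff_one_lt_mul₀ hx'] at hn
      nlinarith
  refine le_antisymm ?_ ?_
  · have : max |a| |b| = |(max |a| |b|)| := (abs_of_nonneg (by positivity)).symm
    rw [this, ← morreyNorm_smul hp]
    refine morreyNorm_mono hp fun x => ?_
    rw [hfF, Pi.smul_apply, smul_eq_mul, abs_mul, abs_mul, ← this]
    gcongr
    split_ifs
    exacts [le_max_left _ _, le_max_right _ _]
  · rcases max_choice |a| |b| with h | h <;> rw [h]
    · rw [← hin, ← morreyNorm_smul hp]
      refine morreyNorm_mono hp fun x => ?_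
      rw [hfF]
      by_cases hx : ‖x‖ < 1
      · simp [hx, abs_mul]
      · simp [hx, abs_mul]
        positivity
    · rw [← hout, ← morreyNorm_smul hp]
      refine morreyNorm_mono hp fun x => ?_
      rw [hfF]
      by_cases hx : ‖x‖ < 1
      · simp [hx, abs_mul]
        positivity
      · simp [hx, not_lt.1 hx, abs_mul]

end

/-- For `1 ≤ p < q < ∞`, `d ≥ 1`, `0 < r < 1`, `f(x) = |x|^(-d/q)`, `g = χ_(0,1)(|x|) f`,
`h = f - g` and `u = (1+r)g + (1-r)h`, the Dunkl–Williams expression for the pair `(f, u)`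
equals `(4 + 2r)/(1 + r)`. -/
theorem morreyNorm_dunklWilliams_expr (p q : ℝ) (d : ℕ) (hp : 1 ≤ p) (hpq : p < q) (hd : 1 ≤ d)
    (r : ℝ) (hr0 : 0 < r) (hr1 : r < 1)
    (f g h u : EuclideanSpace ℝ (Fin d) → ℝ)
    (hf : f = fun x => ‖x‖ ^ (-(d : ℝ) / q))
    (hg : g = fun x => if 0 < ‖x‖ ∧ ‖x‖ < 1 then f x else 0)
    (hh : h = f - g)
    (hu : u = (1 + r) • g + (1 - r) • h) :
    ((morreyNorm p q d f + morreyNorm p q d u) / morreyNorm p q d (f - u)) *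
        morreyNorm p q d
          ((morreyNorm p q d f).toReal⁻¹ • f - (morreyNorm p q d u).toReal⁻¹ • u) =
      ENNReal.ofReal ((4 + 2 * r) / (1 + r)) := by
  have hp0 : 0 < p := by linarith
  have hq0 : 0 < q := by linarith
  have hr' : 0 < 1 + r := by linarith
  have hd0 : (d : ℝ) ≠ 0 := by positivity
  have hNtop : morreyNorm p q d f ≠ ∞ := hf ▸ morreyNorm_norm_rpow_ne_top hp0 hpq hd
  have hN0 : morreyNorm p q d f ≠ 0 := hf ▸ morreyNorm_norm_rpow_ne_zero hp0 hpq hd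
  have hgx : ∀ x, g x = if ‖x‖ < 1 then f x else 0 := fun x => by
    by_cases hx : x = 0
    · have : f 0 = 0 := by
        rw [hf]
        simp only [norm_zero]
        exact Real.zero_rpow (by simp [hd0, hq0.ne', neg_div])
      simp [hg, hx, this]
    · simp [hg, hx]
  have key : ∀ (a b : ℝ) (F : EuclideanSpace ℝ (Fin d) → ℝ), F = a • g + b • h →
      morreyNorm p q d F = ENNReal.ofReal (max |a| |b|) * morreyNorm p q d f := by
    rintro a b F rfl
    rw [morreyNorm_piecewise_norm_rpow hp0 hpq hd a b, hf]
    intro x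
    rw [← congrFun hf x]
    by_cases hx : ‖x‖ < 1 <;> simp [hh, hgx, hx]
  have hfgh : f = g + h := by simp [hh]
  have hu' : morreyNorm p q d u = ENNReal.ofReal (1 + r) * morreyNorm p q d f := by
    rw [key (1 + r) (1 - r) u hu, abs_of_pos hr', abs_of_pos (by linarith),
      max_eq_left (by linarith)]
  have hfu : morreyNorm p q d (f - u) = ENNReal.ofReal r * morreyNorm p q d f := by
    rw [key (-r) r (f - u) (by rw [hu, hh]; module), abs_neg, max_self, abs_of_pos hr0]
  obtain ⟨N, hN, hNf⟩ : ∃ N : ℝ, 0 < N ∧ morreyNorm p q d f = ENNReal.ofReal N :=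
    ⟨_, ENNReal.toReal_pos hN0 hNtop, (ENNReal.ofReal_toReal hNtop).symm⟩
  have hlast : morreyNorm p q d
      ((morreyNorm p q d f).toReal⁻¹ • f - (morreyNorm p q d u).toReal⁻¹ • u)
        = ENNReal.ofReal (2 * r / (1 + r) / N) * morreyNorm p q d f := by
    have hc : 0 < 2 * r / (1 + r) / N := by positivity
    rw [key 0 (2 * r / (1 + r) / N), abs_zero, abs_of_pos hc, max_eq_right hc.le]
    rw [hu', hNf, ← ENNReal.ofReal_mul hr'.le, ENNReal.toReal_ofReal hN.le,
      ENNReal.toReal_ofReal (by positivity), hu]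
    ext x
    simp only [hfgh, Pi.sub_apply, Pi.smul_apply, Pi.add_apply, smul_eq_mul]
    field_simp
    ring
  rw [hlast, hu', hfu, hNf, ← ENNReal.ofReal_mul hr'.le, ← ENNReal.ofReal_mul hr0.le,
    ← ENNReal.ofReal_mul (by positivity), ← ENNReal.ofReal_add hN.le (by positivity),
    ← ENNReal.ofReal_div_of_pos (by positivity), ← ENNReal.ofReal_mul (by positivity)]
  congr 1
  field_simp
  ring
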